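/- Suppose V̂ satisfies the Bellman equation for π. Then for every action a and every k with 1 ≤ k ≤ N−1, the per-step variance of the hindsight-weighted TD error is at most that of the indicator-weighted TD error: Var_π((p_k(a|s,S_k)/π(a|s))·δ_k | S_0 = s) ≤ Var_π((1(A_0=a)/π(a|s))·δ_k | S_0 = s). -/

import Mathlib

open Finset

attribute [local instance] Classical.propDecidable

namespace HCA

/-- A trajectory of horizon `N`: the actions taken at steps `0, …, N-1` and the
states reached after each step (the start state is fixed separately). -/
abbrev Traj (S A : Type*) (N : ℕ) : Type _ := (Fin N → A) × (Fin N → S)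

variable {S A : Type*} [Fintype S] [Fintype A] [Nonempty S] [Nonempty A]

/-- The state `S_k` of a trajectory with start state `s`. -/
def st {N : ℕ} (s : S) (τ : Traj S A N) : ℕ → S
  | 0 => s
  | k + 1 => if h : k < N then τ.2 ⟨k, h⟩ else s

/-- The action `A_k` of a trajectory. -/
noncomputable def ac {N : ℕ} (τ : Traj S A N) (k : ℕ) : A :=
  if h : k < N then τ.1 ⟨k, h⟩ else Classical.arbitrary A

/-- The probability `P_π(τ) = ∏_{k=0}^{N-1} π(A_k|S_k)·P(S_{k+1}|S_k,A_k)` of a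
trajectory starting at `s`. -/
noncomputable def trajP (π : S → A → ℝ) (P : S → A → S → ℝ) (s : S) (N : ℕ)
    (τ : Traj S A N) : ℝ :=
  ∏ k : Fin N, π (st s τ k) (τ.1 k) * P (st s τ k) (τ.1 k) (st s τ (k + 1))

/-- Expectation `E_π[f | S_0 = s]` over trajectories. -/
noncomputable def expct (π : S → A → ℝ) (P : S → A → S → ℝ) (s : S) (N : ℕ)
    (f : Traj S A N → ℝ) : ℝ :=
  ∑ τ : Traj S A N, trajP π P s N τ * f τ

/-- Variance `Var_π(f | S_0 = s)` over trajectories. -/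
noncomputable def vr (π : S → A → ℝ) (P : S → A → S → ℝ) (s : S) (N : ℕ)
    (f : Traj S A N → ℝ) : ℝ :=
  expct π P s N (fun τ => (f τ - expct π P s N f) ^ 2)

/-- Covariance `cov_π(f, g | S_0 = s)` over trajectories. -/
noncomputable def cv (π : S → A → ℝ) (P : S → A → S → ℝ) (s : S) (N : ℕ)
    (f g : Traj S A N → ℝ) : ℝ :=
  expct π P s N (fun τ => (f τ - expct π P s N f) * (g τ - expct π P s N g))

/-- Probability `P_π(E | S_0 = s)` of an event `E` on trajectories. -/
noncomputable def prE (π : S → A → ℝ) (P : S → A → S → ℝ) (s : S) (N : ℕ)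
    (E : Traj S A N → Prop) : ℝ :=
  ∑ τ : Traj S A N, if E τ then trajP π P s N τ else 0

/-- The TD error `δ_k = r(S_k,A_k) + γ·V̂(S_{k+1}) − V̂(S_k)`. -/
noncomputable def td (r : S → A → ℝ) (γ : ℝ) (V : S → ℝ) (s : S) {N : ℕ}
    (τ : Traj S A N) (k : ℕ) : ℝ :=
  r (st s τ k) (ac τ k) + γ * V (st s τ (k + 1)) - V (st s τ k)

/-- `p_k(s'|s,a) = P_π(S_k = s' | S_0 = s, A_0 = a)
  = P_π(A_0 = a, S_k = s' | S_0 = s) / π(a|s)`. -/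
noncomputable def pkSA (π : S → A → ℝ) (P : S → A → S → ℝ) (s : S) (N k : ℕ)
    (a : A) (s' : S) : ℝ :=
  prE π P s N (fun τ => ac τ 0 = a ∧ st s τ k = s') / π s a

/-- `p_k(s'|s) = Σ_a π(a|s)·p_k(s'|s,a)`. -/
noncomputable def pkS (π : S → A → ℝ) (P : S → A → S → ℝ) (s : S) (N k : ℕ)
    (s' : S) : ℝ :=
  ∑ a : A, π s a * pkSA π P s N k a s'

/-- The hindsight probability `p_k(a|s,s')`, defined as
`P_π(A_0 = a, S_k = s' | S_0 = s)/p_k(s'|s)` when `p_k(s'|s) > 0` and `0` otherwise. -/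
noncomputable def pkA (π : S → A → ℝ) (P : S → A → S → ℝ) (s : S) (N k : ℕ)
    (a : A) (s' : S) : ℝ :=
  if 0 < pkS π P s N k s' then
    prE π P s N (fun τ => ac τ 0 = a ∧ st s τ k = s') / pkS π P s N k s'
  else 0

/-- The `N`-step Monte-Carlo advantage estimator
`Â^MC_N(a) = (1(A_0=a)/π(a|s))·Σ_{k=0}^{N−1} γ^k·δ_k`. -/
noncomputable def mcEst (π : S → A → ℝ) (r : S → A → ℝ) (γ : ℝ) (V : S → ℝ)
    (s : S) (N : ℕ) (a : A) (τ : Traj S A N) : ℝ :=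
  ((if ac τ 0 = a then (1 : ℝ) else 0) / π s a) * ∑ k ∈ range N, γ ^ k * td r γ V s τ k

/-- The `N`-step δHCA advantage estimator
`Â^δHCA_N(a) = (1(A_0=a)/π(a|s))·δ_0 + Σ_{k=1}^{N−1} γ^k·(p_k(a|s,S_k)/π(a|s))·δ_k`. -/
noncomputable def dhcaEst (π : S → A → ℝ) (P : S → A → S → ℝ) (r : S → A → ℝ)
    (γ : ℝ) (V : S → ℝ) (s : S) (N : ℕ) (a : A) (τ : Traj S A N) : ℝ :=
  ((if ac τ 0 = a then (1 : ℝ) else 0) / π s a) * td r γ V s τ 0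
    + ∑ k ∈ Ico 1 N, γ ^ k * (pkA π P s N k a (st s τ k) / π s a) * td r γ V s τ k

/-- `V` satisfies the Bellman equation for `π`:
`V(s₀) = Σ_a π(a|s₀)·(r(s₀,a) + γ·Σ_{s'} P(s'|s₀,a)·V(s'))` for every state `s₀`. -/
def IsBellman (π : S → A → ℝ) (P : S → A → S → ℝ) (r : S → A → ℝ) (γ : ℝ)
    (V : S → ℝ) : Prop :=
  ∀ s₀ : S, V s₀ = ∑ a : A, π s₀ a * (r s₀ a + γ * ∑ s' : S, P s₀ a s' * V s')

/-- The conditional second moment `E_π[δ_k² | S_0 = s, S_k = s']`,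
defined as `(Σ_{τ : S_k = s'} P_π(τ)·δ_k(τ)²)/p_k(s'|s)`. -/
noncomputable def sndMom (π : S → A → ℝ) (P : S → A → S → ℝ) (r : S → A → ℝ)
    (γ : ℝ) (V : S → ℝ) (s : S) (N k : ℕ) (s' : S) : ℝ :=
  (∑ τ : Traj S A N, if st s τ k = s' then trajP π P s N τ * (td r γ V s τ k) ^ 2 else 0)
    / pkS π P s N k s'

section aux

/-- Extend a trajectory by one step. -/
def ext {S A : Type*} {N : ℕ} (τ : Traj S A N) (a : A) (x : S) : Traj S A (N + 1) :=
  (Fin.snoc (α := fun _ => A) τ.1 a, Fin.snoc (α := fun _ => S) τ.2 x)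

/-- Extension as an equivalence. -/
def extEquiv (S A : Type*) (N : ℕ) : (Traj S A N × (A × S)) ≃ Traj S A (N + 1) where
  toFun p := ext p.1 p.2.1 p.2.2
  invFun τ := ((Fin.init (α := fun _ => A) τ.1, Fin.init (α := fun _ => S) τ.2),
    (τ.1 (Fin.last N), τ.2 (Fin.last N)))
  left_inv p := by
    obtain ⟨⟨u, v⟩, a, x⟩ := p
    simp [ext]
  right_inv τ := by
    obtain ⟨u, v⟩ := τ
    simp [ext]

theorem st_ext_of_le {S A : Type*} {N : ℕ} (s : S) (τ : Traj S A N) (a : A) (x : S) (j : ℕ)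
    (hj : j ≤ N) : st s (ext τ a x) j = st s τ j := by
  cases j with
  | zero => rfl
  | succ j =>
    have h1 : j < N := hj
    have h2 : j < N + 1 := by omega
    simp [st, ext, h1, h2, Fin.snoc]

theorem st_ext_last {S A : Type*} {N : ℕ} (s : S) (τ : Traj S A N) (a : A) (x : S) :
    st s (ext τ a x) (N + 1) = x := by
  simp [st, ext, Fin.snoc]

theorem ac_ext_of_lt {S A : Type*} [Nonempty A] {N : ℕ} (τ : Traj S A N) (a : A) (x : S) (j : ℕ)
    (hj : j < N) : ac (ext τ a x) j = ac τ j := by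
  have h2 : j < N + 1 := by omega
  simp [ac, ext, hj, h2, Fin.snoc]

theorem ac_ext_last {S A : Type*} [Nonempty A] {N : ℕ} (τ : Traj S A N) (a : A) (x : S) :
    ac (ext τ a x) N = a := by
  simp [ac, ext, Fin.snoc]

theorem trajP_ext {S A : Type*} (π : S → A → ℝ) (P : S → A → S → ℝ) (s : S) (N : ℕ)
    (τ : Traj S A N) (a : A) (x : S) :
    trajP π P s (N + 1) (ext τ a x)
      = trajP π P s N τ * (π (st s τ N) a * P (st s τ N) a x) := by
  unfold trajP
  rw [Fin.prod_univ_castSucc]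
  congr 1
  · apply Finset.prod_congr rfl
    intro i _
    have h1 := st_ext_of_le s τ a x i.1 i.2.le
    have h2 := st_ext_of_le s τ a x (i.1 + 1) i.2
    have h3 : (ext τ a x).1 i.castSucc = τ.1 i := by simp [ext]
    simp only [Fin.val_castSucc, h1, h2, h3]
  · have h1 := st_ext_of_le s τ a x N le_rfl
    have h2 := st_ext_last s τ a x
    have h3 : (ext τ a x).1 (Fin.last N) = a := by simp [ext]
    simp only [Fin.val_last, h1, h2, h3]

theorem expct_succ {S A : Type*} [Fintype S] [Fintype A] (π : S → A → ℝ) (P : S → A → S → ℝ)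
    (s : S) (N : ℕ) (f : Traj S A (N + 1) → ℝ) :
    expct π P s (N + 1) f = expct π P s N (fun τ => ∑ a : A, ∑ x : S,
      π (st s τ N) a * P (st s τ N) a x * f (ext τ a x)) := by
  unfold expct
  rw [← (extEquiv S A N).sum_comp, Fintype.sum_prod_type]
  apply Finset.sum_congr rfl
  intro τ _
  rw [Fintype.sum_prod_type, Finset.mul_sum]
  apply Finset.sum_congr rfl
  intro b _
  rw [Finset.mul_sum]
  apply Finset.sum_congr rfl
  intro x _
  have : (extEquiv S A N) (τ, (b, x)) = ext τ b x := rfl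
  rw [this, trajP_ext]
  ring

theorem sum_one {S A : Type*} [Fintype S] [Fintype A] (π : S → A → ℝ) (P : S → A → S → ℝ)
    (hπsum : ∀ s₀ : S, ∑ a : A, π s₀ a = 1)
    (hPsum : ∀ (s₀ : S) (a : A), ∑ s' : S, P s₀ a s' = 1) (y : S) (c : ℝ) :
    ∑ a : A, ∑ x : S, π y a * P y a x * c = c := by
  simp_rw [← Finset.sum_mul, ← Finset.mul_sum, hPsum, mul_one, hπsum, one_mul]

theorem key {S A : Type*} [Fintype S] [Fintype A] [Nonempty A]
    (π : S → A → ℝ) (P : S → A → S → ℝ) (s : S)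
    (hπsum : ∀ s₀ : S, ∑ a : A, π s₀ a = 1)
    (hPsum : ∀ (s₀ : S) (a : A), ∑ s' : S, P s₀ a s' = 1)
    (k : ℕ) (hk : 1 ≤ k) (g : A → S → ℝ) (h : S → A → S → ℝ) (N : ℕ) (hN : k + 1 ≤ N) :
    expct π P s N (fun τ => g (ac τ 0) (st s τ k) * h (st s τ k) (ac τ k) (st s τ (k + 1)))
      = expct π P s N (fun τ => g (ac τ 0) (st s τ k) *
          ∑ b : A, ∑ x : S, π (st s τ k) b * P (st s τ k) b x * h (st s τ k) b x) := by
  induction N, hN using Nat.le_induction with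
  | base =>
    rw [expct_succ, expct_succ]
    congr 1
    funext τ
    simp only [st_ext_last, ac_ext_last, st_ext_of_le s τ _ _ k le_rfl,
      ac_ext_of_lt τ _ _ 0 hk]
    rw [sum_one π P hπsum hPsum, Finset.mul_sum]
    apply Finset.sum_congr rfl
    intro b _
    rw [Finset.mul_sum]
    apply Finset.sum_congr rfl
    intro x _
    ring
  | succ N hN ih =>
    rw [expct_succ, expct_succ]
    have h0 : 0 < N := by omega
    have h1 : k ≤ N := by omega
    have h2 : k < N := by omega
    simp only [st_ext_of_le s _ _ _ k h1, st_ext_of_le s _ _ _ (k + 1) hN,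
      ac_ext_of_lt _ _ _ 0 h0, ac_ext_of_lt _ _ _ k h2, sum_one π P hπsum hPsum]
    exact ih

theorem trajP_nonneg {S A : Type*} (π : S → A → ℝ) (P : S → A → S → ℝ)
    (hπpos : ∀ s₀ a, 0 < π s₀ a) (hPnn : ∀ s₀ a s', 0 ≤ P s₀ a s') (s : S) (N : ℕ)
    (τ : Traj S A N) : 0 ≤ trajP π P s N τ :=
  Finset.prod_nonneg fun _ _ => mul_nonneg (hπpos _ _).le (hPnn _ _ _)

theorem pkS_eq {S A : Type*} [Fintype S] [Fintype A] [Nonempty A]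
    (π : S → A → ℝ) (P : S → A → S → ℝ) (hπpos : ∀ s₀ a, 0 < π s₀ a) (s : S) (N k : ℕ) (x : S) :
    pkS π P s N k x = ∑ b : A, prE π P s N (fun τ => ac τ 0 = b ∧ st s τ k = x) := by
  unfold pkS pkSA
  apply Finset.sum_congr rfl
  intro b _
  have := (hπpos s b).ne'
  field_simp

theorem pkS_eq_prE {S A : Type*} [Fintype S] [Fintype A] [Nonempty A]
    (π : S → A → ℝ) (P : S → A → S → ℝ) (hπpos : ∀ s₀ a, 0 < π s₀ a) (s : S) (N k : ℕ) (x : S) :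
    pkS π P s N k x = prE π P s N (fun τ => st s τ k = x) := by
  rw [pkS_eq π P hπpos]
  unfold prE
  rw [Finset.sum_comm]
  apply Finset.sum_congr rfl
  intro τ _
  by_cases hx : st s τ k = x <;> simp [hx]

theorem expct_ind {S A : Type*} [Fintype S] [Fintype A]
    (π : S → A → ℝ) (P : S → A → S → ℝ) (s : S) (N k : ℕ) (E : Traj S A N → Prop) (g : S → ℝ) :
    expct π P s N (fun τ => (if E τ then 1 else 0) * g (st s τ k))
      = ∑ x : S, prE π P s N (fun τ => E τ ∧ st s τ k = x) * g x := by
  unfold prE expct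
  simp_rw [Finset.sum_mul]
  rw [Finset.sum_comm]
  apply Finset.sum_congr rfl
  intro τ _
  by_cases hE : E τ <;> simp [hE]

end aux

theorem stmt_8 {S A : Type*} [Fintype S] [Fintype A] [Nonempty S] [Nonempty A]
    (π : S → A → ℝ) (P : S → A → S → ℝ) (r : S → A → ℝ) (γ : ℝ)
    (N : ℕ) (s : S)
    (hπpos : ∀ s₀ a, 0 < π s₀ a) (hπsum : ∀ s₀ : S, ∑ a : A, π s₀ a = 1)
    (hPnn : ∀ s₀ a s', 0 ≤ P s₀ a s') (hPsum : ∀ (s₀ : S) (a : A), ∑ s' : S, P s₀ a s' = 1)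
    (hγ0 : 0 ≤ γ) (hγ1 : γ ≤ 1) (hN : 1 ≤ N)
    (V : S → ℝ) (hV : IsBellman π P r γ V)
    (a : A) (k : ℕ) (hk1 : 1 ≤ k) (hk2 : k ≤ N - 1) :
    vr π P s N (fun τ => pkA π P s N k a (st s τ k) / π s a * td r γ V s τ k)
      ≤ vr π P s N (fun τ => (if ac τ 0 = a then (1 : ℝ) else 0) / π s a * td r γ V s τ k) := by
  have hkN : k + 1 ≤ N := by omega
  set h1 : S → A → S → ℝ := fun y b x => r y b + γ * V x - V y with hh1
  set H2 : S → ℝ := fun y => ∑ b : A, ∑ x : S, π y b * P y b x * (h1 y b x) ^ 2 with hH2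
  have hH2nn : ∀ y, 0 ≤ H2 y := fun y => Finset.sum_nonneg fun b _ =>
    Finset.sum_nonneg fun x _ => mul_nonneg (mul_nonneg (hπpos _ _).le (hPnn _ _ _)) (sq_nonneg _)
  have hH1 : ∀ y, ∑ b : A, ∑ x : S, π y b * P y b x * h1 y b x = 0 := by
    intro y
    have e : ∀ b x, π y b * P y b x * h1 y b x
        = π y b * P y b x * r y b + γ * (π y b * (P y b x * V x)) - π y b * P y b x * V y := by
      intro b x
      simp only [hh1]
      ring
    simp_rw [e, Finset.sum_sub_distrib, Finset.sum_add_distrib]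
    rw [sum_one π P hπsum hPsum, hV y]
    simp_rw [← Finset.sum_mul, ← Finset.mul_sum, hPsum, mul_one, mul_add, Finset.sum_add_distrib]
    rw [Finset.mul_sum]
    rw [sub_eq_zero]
    congr 1
    apply Finset.sum_congr rfl
    intro b _
    ring
  have mean0 : ∀ g : A → S → ℝ,
      expct π P s N (fun τ => g (ac τ 0) (st s τ k) * td r γ V s τ k) = 0 := by
    intro g
    refine (key π P s hπsum hPsum k hk1 g h1 N hkN).trans ?_
    simp [hH1, expct]
  have var : ∀ g : A → S → ℝ,
      vr π P s N (fun τ => g (ac τ 0) (st s τ k) * td r γ V s τ k)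
        = expct π P s N (fun τ => (g (ac τ 0) (st s τ k)) ^ 2 * H2 (st s τ k)) := by
    intro g
    unfold vr
    rw [mean0 g]
    simp only [sub_zero, mul_pow]
    exact key π P s hπsum hPsum k hk1 (fun b y => (g b y) ^ 2) (fun y b x => (h1 y b x) ^ 2) N hkN
  rw [var (fun _ y => pkA π P s N k a y / π s a),
    var (fun b _ => (if b = a then (1 : ℝ) else 0) / π s a)]
  have e1 := expct_ind π P s N k (fun _ => True) (fun y => (pkA π P s N k a y / π s a) ^ 2 * H2 y)
  have e2 := expct_ind π P s N k (fun τ => ac τ 0 = a) (fun y => (1 / π s a) ^ 2 * H2 y)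
  simp only [if_true, one_mul, true_and] at e1
  rw [e1]
  have e3 : (fun τ : Traj S A N => ((if ac τ 0 = a then (1 : ℝ) else 0) / π s a) ^ 2
      * H2 (st s τ k)) = (fun τ : Traj S A N => (if ac τ 0 = a then (1 : ℝ) else 0)
      * ((1 / π s a) ^ 2 * H2 (st s τ k))) := by
    funext τ
    split_ifs <;> simp
  rw [e3, e2]
  apply Finset.sum_le_sum
  intro x _
  rw [← pkS_eq_prE π P hπpos]
  have hJ : ∀ b, 0 ≤ prE π P s N (fun τ => ac τ 0 = b ∧ st s τ k = x) := by
    intro b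
    unfold prE
    apply Finset.sum_nonneg
    intro τ _
    split_ifs
    · exact trajP_nonneg π P hπpos hPnn s N τ
    · exact le_rfl
  have hle : prE π P s N (fun τ => ac τ 0 = a ∧ st s τ k = x) ≤ pkS π P s N k x := by
    rw [pkS_eq π P hπpos]
    exact Finset.single_le_sum (f := fun b => prE π P s N (fun τ => ac τ 0 = b ∧ st s τ k = x))
      (fun b _ => hJ b) (Finset.mem_univ a)
  have hc : 0 ≤ (1 / π s a) ^ 2 * H2 x := mul_nonneg (sq_nonneg _) (hH2nn x)
  have main : pkS π P s N k x * (pkA π P s N k a x) ^ 2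
      ≤ prE π P s N (fun τ => ac τ 0 = a ∧ st s τ k = x) := by
    unfold pkA
    split_ifs with hp
    · have hJa := hJ a
      generalize prE π P s N (fun τ => ac τ 0 = a ∧ st s τ k = x) = J at *
      generalize pkS π P s N k x = p at *
      have : p * (J / p) ^ 2 = J * (J / p) := by field_simp
      rw [this]
      exact mul_le_of_le_one_right hJa ((div_le_one hp).2 hle)
    · simpa using hJ a
  calc _ = (pkS π P s N k x * (pkA π P s N k a x) ^ 2) * ((1 / π s a) ^ 2 * H2 x) := by ring
    _ ≤ _ := mul_le_mul_of_nonneg_right main hc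

end HCA
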